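/- arXiv:cs/0203005 — 3 statements merged into one kernel-verified Lean document; each statement's English description precedes it below -/
import Mathlib

section
/- Let Π be an ordered logic program and X a consistent answer set of 𝒯(Π). Then the relation <_X (defined by r <_X r' iff (n_r ≺ n_{r'}) ∈ X) is a strict partial order on Π (i.e., it is transitive and antisymmetric, hence irreflexive). -/
set_option autoImplicit false

namespace ASP

/-- Literals over a set of atoms: an atom or its classical negation. -/
inductive Lit (α : Type) : Type
  | pos : α → Lit α
  | neg : α → Lit α

namespace Lit

/-- The atom of a literal. -/
def atom {α : Type} : Lit α → α
  | pos a => a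
  | neg a => a

/-- Map a function over the atom of a literal. -/
def map {α β : Type} (f : α → β) : Lit α → Lit β
  | pos a => pos (f a)
  | neg a => neg (f a)

end Lit

/-- A rule `head ← bodyP, not bodyN`. -/
structure Rule (α : Type) : Type where
  head : Lit α
  bodyP : Set (Lit α)
  bodyN : Set (Lit α)

/-- Map a function over the atoms of a rule. -/
def Rule.map {α β : Type} (f : α → β) (r : Rule α) : Rule β :=
  ⟨r.head.map f, Lit.map f '' r.bodyP, Lit.map f '' r.bodyN⟩

/-- The literals occurring in a rule. -/
def ruleLits {α : Type} (r : Rule α) : Set (Lit α) := insert r.head (r.bodyP ∪ r.bodyN)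

/-- A set of literals is consistent iff it contains no complementary pair. -/
def consistent {α : Type} (X : Set (Lit α)) : Prop := ¬ ∃ a, Lit.pos a ∈ X ∧ Lit.neg a ∈ X

/-- Logically closed: consistent or the set of all literals. -/
def logClosed {α : Type} (X : Set (Lit α)) : Prop := consistent X ∨ X = Set.univ

/-- The smallest logically closed set of literals containing `S`. -/
def logClosure {α : Type} (S : Set (Lit α)) : Set (Lit α) := ⋂₀ {Y | S ⊆ Y ∧ logClosed Y}

/-- `X` is closed under the (basic) program `P`. -/
def closedUnder {α : Type} (P : Set (Rule α)) (X : Set (Lit α)) : Prop :=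
  ∀ r ∈ P, r.bodyP ⊆ X → r.head ∈ X

/-- `Th P`: smallest set which is logically closed and closed under the basic program `P`. -/
def Th {α : Type} (P : Set (Rule α)) : Set (Lit α) := ⋂₀ {X | logClosed X ∧ closedUnder P X}

/-- A rule is defeated by `X` iff `bodyN r ∩ X ≠ ∅`. -/
def defeated {α : Type} (r : Rule α) (X : Set (Lit α)) : Prop := ∃ L ∈ r.bodyN, L ∈ X

/-- The Gelfond-Lifschitz reduct of `P` relative to `X`. -/
def reduct {α : Type} (P : Set (Rule α)) (X : Set (Lit α)) : Set (Rule α) :=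
  {r' | ∃ r ∈ P, ¬ defeated r X ∧ r' = Rule.mk r.head r.bodyP ∅}

/-- `X` is an answer set of `P` iff `Th (P^X) = X`. -/
def answerSet {α : Type} (P : Set (Rule α)) (X : Set (Lit α)) : Prop := Th (reduct P X) = X

/-- Generating rules of `X` from `P`. -/
def GR {α : Type} (P : Set (Rule α)) (X : Set (Lit α)) : Set (Rule α) :=
  {r | r ∈ P ∧ r.bodyP ⊆ X ∧ ¬ defeated r X}

/-- Heads of the rules occurring before position `i` in the list `l`. -/
def headsBefore {α : Type} (l : List (Rule α)) (i : ℕ) : Set (Lit α) :=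
  {L | L ∈ (l.take i).map Rule.head}

/-- The sequence of rules `l` is grounded. -/
def groundedList {α : Type} (l : List (Rule α)) : Prop :=
  ∀ (i : ℕ) (h : i < l.length),
    consistent (headsBefore l i) → (l.get ⟨i, h⟩).bodyP ⊆ headsBefore l i

/-- `l` is an enumeration of the set `S` of rules. -/
def enumerates {α : Type} (l : List (Rule α)) (S : Set (Rule α)) : Prop :=
  l.Nodup ∧ {r | r ∈ l} = S

/-- The one-step consequence operator for basic programs. -/
def TOp {α : Type} (P : Set (Rule α)) (X : Set (Lit α)) : Set (Lit α) :=
  {L | (consistent X ∧ ∃ r ∈ P, r.bodyP ⊆ X ∧ r.head = L) ∨ ¬ consistent X}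

/-- Iterated application of `TOp`, starting from `∅`. -/
def TIter {α : Type} (P : Set (Rule α)) : ℕ → Set (Lit α)
  | 0 => ∅
  | n + 1 => TOp P (TIter P n)

/-- A strict partial order whose field is contained in `P`. -/
def strictOn {γ : Type} (P : Set γ) (lt : γ → γ → Prop) : Prop :=
  (∀ a b, lt a b → a ∈ P ∧ b ∈ P) ∧ (∀ a b c, lt a b → lt b c → lt a c) ∧ (∀ a, ¬ lt a a)

/-- A total strict order on `P`. -/
def totalStrictOn {γ : Type} (P : Set γ) (ll : γ → γ → Prop) : Prop :=
  (∀ a b, ll a b → a ∈ P ∧ b ∈ P) ∧ (∀ a b c, ll a b → ll b c → ll a c) ∧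
    (∀ a, ¬ ll a a) ∧ (∀ a ∈ P, ∀ b ∈ P, a ≠ b → ll a b ∨ ll b a)

/-! ## Ordered logic programs -/

/-- Atoms of the language of an ordered logic program: regular atoms and
preference atoms `n ≺ m` over names. -/
inductive OAtom (α N : Type) : Type
  | reg : α → OAtom α N
  | pref : N → N → OAtom α N

/-- Rules of an ordered logic program. -/
abbrev ORule (α N : Type) := Rule (OAtom α N)

/-- The preference literal `(n ≺ m)`. -/
def prefLit {α N : Type} (n m : N) : Lit (OAtom α N) := Lit.pos (OAtom.pref n m)

/-- A literal over a regular atom. -/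
def regLitO {α N : Type} (L : Lit (OAtom α N)) : Prop := ∃ a, L.atom = OAtom.reg a

/-- No preference atom occurs in the rule `r`. -/
def noPref {α N : Type} (r : ORule α N) : Prop := ∀ L ∈ ruleLits r, regLitO L

/-- The dynamically induced preference `r <_X r'`, at the level of the language `𝓛`. -/
def precXO {α N : Type} (nm : ORule α N → N) (X : Set (Lit (OAtom α N)))
    (r s : ORule α N) : Prop :=
  prefLit (nm r) (nm s) ∈ X

/-- The fact `(n_r ≺ n_s) ←`. -/
def prefFactO {α N : Type} (nm : ORule α N → N) (r s : ORule α N) : ORule α N :=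
  ⟨prefLit (nm r) (nm s), ∅, ∅⟩

/-- The transitivity rule `t(r,s,t)`. -/
def tRuleO {α N : Type} (nm : ORule α N → N) (r s t : ORule α N) : ORule α N :=
  ⟨prefLit (nm r) (nm t), {prefLit (nm r) (nm s), prefLit (nm s) (nm t)}, ∅⟩

/-- The antisymmetry rule `as(r,s)`. -/
def asRuleO {α N : Type} (nm : ORule α N → N) (r s : ORule α N) : ORule α N :=
  ⟨Lit.neg (OAtom.pref (nm s) (nm r)), {prefLit (nm r) (nm s)}, ∅⟩

/-- `TA(Π)`: `Π` together with all transitivity and antisymmetry rules. -/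
def TA {α N : Type} (P : Set (ORule α N)) (nm : ORule α N → N) : Set (ORule α N) :=
  P ∪ {ru | ∃ r ∈ P, ∃ s ∈ P, ∃ t ∈ P, ru = tRuleO nm r s t}
    ∪ {ru | ∃ r ∈ P, ∃ s ∈ P, ru = asRuleO nm r s}

/-- The statically ordered program `(Π,<)`, identified with
`Π ∪ {(n_r ≺ n_{r'}) ← ∣ r < r'}`. -/
def staticProg {α N : Type} (P : Set (ORule α N)) (nm : ORule α N → N)
    (lt : ORule α N → ORule α N → Prop) : Set (ORule α N) :=
  P ∪ {ru | ∃ r ∈ P, ∃ s ∈ P, lt r s ∧ ru = prefFactO nm r s}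

/-- The heads of the generating rules occurring before position `i` in `l`. -/
def grHeadsBefore {α : Type} (l : List (Rule α)) (G : Set (Rule α)) (i : ℕ) :
    Set (Lit α) :=
  {L | ∃ j, ∃ h : j < l.length, j < i ∧ l.get ⟨j, h⟩ ∈ G ∧ (l.get ⟨j, h⟩).head = L}

/-- `X` is a `<`-preserving answer set of the statically ordered program `(P,lt)`
(Definition 1). -/
def staticPreserving {α N : Type} (P : Set (ORule α N))
    (lt : ORule α N → ORule α N → Prop) (X : Set (Lit (OAtom α N))) : Prop :=
  answerSet P X ∧ consistent X ∧
    ∃ l : List (ORule α N), enumerates l (GR P X) ∧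
      (∀ (i : ℕ) (h : i < l.length), (l.get ⟨i, h⟩).bodyP ⊆ headsBefore l i) ∧
      (∀ (i j : ℕ) (hi : i < l.length) (hj : j < l.length),
        lt (l.get ⟨i, hi⟩) (l.get ⟨j, hj⟩) → j < i) ∧
      (∀ (i : ℕ) (hi : i < l.length), ∀ r' ∈ P, r' ∉ GR P X →
        lt (l.get ⟨i, hi⟩) r' →
          ¬ r'.bodyP ⊆ X ∨ ∃ L ∈ r'.bodyN, L ∈ headsBefore l i)

/-- `X` is a `<_X`-preserving answer set of the program `P` (standing for `TA(Π)`;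
Definition 3). -/
def dynPreserving {α N : Type} (nm : ORule α N → N) (P : Set (ORule α N))
    (X : Set (Lit (OAtom α N))) : Prop :=
  answerSet P X ∧ consistent X ∧
    ∃ l : List (ORule α N), enumerates l P ∧
      (∀ (i j : ℕ) (hi : i < l.length) (hj : j < l.length),
        precXO nm X (l.get ⟨i, hi⟩) (l.get ⟨j, hj⟩) → j < i) ∧
      (∀ (i j : ℕ) (hi : i < l.length) (hj : j < l.length),
        precXO nm X (l.get ⟨i, hi⟩) (l.get ⟨j, hj⟩) →
          ∃ k, ∃ hk : k < l.length, k < i ∧ l.get ⟨k, hk⟩ ∈ GR P X ∧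
            (l.get ⟨k, hk⟩).head = prefLit (nm (l.get ⟨i, hi⟩)) (nm (l.get ⟨j, hj⟩))) ∧
      (∀ (i : ℕ) (hi : i < l.length), l.get ⟨i, hi⟩ ∈ GR P X →
        (l.get ⟨i, hi⟩).bodyP ⊆ grHeadsBefore l (GR P X) i) ∧
      (∀ (i : ℕ) (hi : i < l.length), l.get ⟨i, hi⟩ ∉ GR P X →
        ¬ (l.get ⟨i, hi⟩).bodyP ⊆ X ∨
          ∃ L ∈ (l.get ⟨i, hi⟩).bodyN, L ∈ grHeadsBefore l (GR P X) i)

/-- Occurrence of a name in a rule (inside some preference atom). -/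
def nameOccurs {α N : Type} (n : N) (r : ORule α N) : Prop :=
  ∃ L ∈ ruleLits r, ∃ m, L.atom = OAtom.pref n m ∨ L.atom = OAtom.pref m n

/-! ## The translation 𝒯 -/

/-- Atoms of the target language `𝓛⁺` of the translation `𝒯`. -/
inductive TAtom (α N : Type) : Type
  | old : OAtom α N → TAtom α N
  | ap : N → TAtom α N
  | bl : N → TAtom α N
  | ok : N → TAtom α N
  | rdy : N → N → TAtom α N

/-- Embedding of `𝓛`-literals into `𝓛⁺`. -/
def oldLit {α N : Type} (L : Lit (OAtom α N)) : Lit (TAtom α N) := L.map TAtom.old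

/-- The preference literal `(n ≺ m)` inside `𝓛⁺`. -/
def tpref {α N : Type} (n m : N) : Lit (TAtom α N) := Lit.pos (TAtom.old (OAtom.pref n m))

def apLit {α N : Type} (n : N) : Lit (TAtom α N) := Lit.pos (TAtom.ap n)
def blLit {α N : Type} (n : N) : Lit (TAtom α N) := Lit.pos (TAtom.bl n)
def okLit {α N : Type} (n : N) : Lit (TAtom α N) := Lit.pos (TAtom.ok n)
def rdyLit {α N : Type} (n m : N) : Lit (TAtom α N) := Lit.pos (TAtom.rdy n m)

/-- `a1(r) : head(r) ← ap(n_r)`. -/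
def a1Rule {α N : Type} (nm : ORule α N → N) (r : ORule α N) : Rule (TAtom α N) :=
  ⟨oldLit r.head, {apLit (nm r)}, ∅⟩

/-- `a2(r) : ap(n_r) ← ok(n_r), body(r)`. -/
def a2Rule {α N : Type} (nm : ORule α N → N) (r : ORule α N) : Rule (TAtom α N) :=
  ⟨apLit (nm r), insert (okLit (nm r)) (oldLit '' r.bodyP), oldLit '' r.bodyN⟩

/-- `b1(r,L⁺) : bl(n_r) ← ok(n_r), not L⁺`. -/
def b1Rule {α N : Type} (nm : ORule α N → N) (r : ORule α N) (L : Lit (OAtom α N)) :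
    Rule (TAtom α N) :=
  ⟨blLit (nm r), {okLit (nm r)}, {oldLit L}⟩

/-- `b2(r,L⁻) : bl(n_r) ← ok(n_r), L⁻`. -/
def b2Rule {α N : Type} (nm : ORule α N → N) (r : ORule α N) (L : Lit (OAtom α N)) :
    Rule (TAtom α N) :=
  ⟨blLit (nm r), {okLit (nm r), oldLit L}, ∅⟩

/-- `c1(r) : ok(n_r) ← rdy(n_r,n_{r_1}), …, rdy(n_r,n_{r_k})`. -/
def c1Rule {α N : Type} (P : Set (ORule α N)) (nm : ORule α N → N) (r : ORule α N) :
    Rule (TAtom α N) :=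
  ⟨okLit (nm r), {L | ∃ s ∈ P, L = rdyLit (nm r) (nm s)}, ∅⟩

/-- `c2(r,s) : rdy(n_r,n_s) ← not (n_r ≺ n_s)`. -/
def c2Rule {α N : Type} (nm : ORule α N → N) (r s : ORule α N) : Rule (TAtom α N) :=
  ⟨rdyLit (nm r) (nm s), ∅, {tpref (nm r) (nm s)}⟩

/-- `c3(r,s) : rdy(n_r,n_s) ← (n_r ≺ n_s), ap(n_s)`. -/
def c3Rule {α N : Type} (nm : ORule α N → N) (r s : ORule α N) : Rule (TAtom α N) :=
  ⟨rdyLit (nm r) (nm s), {tpref (nm r) (nm s), apLit (nm s)}, ∅⟩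

/-- `c4(r,s) : rdy(n_r,n_s) ← (n_r ≺ n_s), bl(n_s)`. -/
def c4Rule {α N : Type} (nm : ORule α N → N) (r s : ORule α N) : Rule (TAtom α N) :=
  ⟨rdyLit (nm r) (nm s), {tpref (nm r) (nm s), blLit (nm s)}, ∅⟩

/-- `t(r,s,t) : (n_r ≺ n_t) ← (n_r ≺ n_s), (n_s ≺ n_t)` inside `𝓛⁺`. -/
def tRuleT {α N : Type} (nm : ORule α N → N) (r s t : ORule α N) : Rule (TAtom α N) :=
  ⟨tpref (nm r) (nm t), {tpref (nm r) (nm s), tpref (nm s) (nm t)}, ∅⟩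

/-- `as(r,s) : ¬(n_s ≺ n_r) ← (n_r ≺ n_s)` inside `𝓛⁺`. -/
def asRuleT {α N : Type} (nm : ORule α N → N) (r s : ORule α N) : Rule (TAtom α N) :=
  ⟨Lit.neg (TAtom.old (OAtom.pref (nm s) (nm r))), {tpref (nm r) (nm s)}, ∅⟩

/-- The set of rules `τ(r)` of Definition 2. -/
def tau {α N : Type} (P : Set (ORule α N)) (nm : ORule α N → N) (r : ORule α N) :
    Set (Rule (TAtom α N)) :=
  {a1Rule nm r, a2Rule nm r, c1Rule P nm r}
    ∪ {ru | ∃ L ∈ r.bodyP, ru = b1Rule nm r L}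
    ∪ {ru | ∃ L ∈ r.bodyN, ru = b2Rule nm r L}
    ∪ {ru | ∃ s ∈ P, ru = c2Rule nm r s ∨ ru = c3Rule nm r s ∨ ru = c4Rule nm r s}
    ∪ {ru | ∃ s ∈ P, ∃ t ∈ P, ru = tRuleT nm r s t}
    ∪ {ru | ∃ s ∈ P, ru = asRuleT nm r s}

/-- The translation `𝒯(Π) = ⋃_{r ∈ Π} τ(r)`. -/
def TTrans {α N : Type} (P : Set (ORule α N)) (nm : ORule α N → N) :
    Set (Rule (TAtom α N)) :=
  {ru | ∃ r ∈ P, ru ∈ tau P nm r}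

/-- `𝒯(Π,<)` for a statically ordered program. -/
def TStatic {α N : Type} (P : Set (ORule α N)) (nm : ORule α N → N)
    (lt : ORule α N → ORule α N → Prop) : Set (Rule (TAtom α N)) :=
  TTrans (staticProg P nm lt) nm

/-- The dynamically induced preference `r <_X r'` read off from an answer set of
the translated program. -/
def precX {α N : Type} (nm : ORule α N → N) (X : Set (Lit (TAtom α N)))
    (r s : ORule α N) : Prop :=
  tpref (nm r) (nm s) ∈ X

/-- The literals of `𝓛⁺` over regular atoms (the set `𝓛_𝒜`). -/
def regLitsT {α N : Type} : Set (Lit (TAtom α N)) :=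
  {L | ∃ a, L.atom = TAtom.old (OAtom.reg a)}

/-- The literals of `𝓛⁺` belonging to the original language `𝓛`. -/
def oldLitsT {α N : Type} : Set (Lit (TAtom α N)) := Set.range oldLit

/-- A rule of `𝒯(Π)` that is an "image" of `r ∈ Π`:
`a2(r)`, or `b1(r,L)`/`b2(r,L)` for some body literal `L` of `r`. -/
def imgRule {α N : Type} (nm : ORule α N → N) (r : ORule α N)
    (ru : Rule (TAtom α N)) : Prop :=
  ru = a2Rule nm r ∨ (∃ L ∈ r.bodyP, ru = b1Rule nm r L) ∨
    (∃ L ∈ r.bodyN, ru = b2Rule nm r L)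

/-! ## The translation 𝒰 (Brewka–Eiter encoding) -/

/-- Atoms of the target language `𝓛°` of the translation `𝒰`. -/
inductive UAtom (α N : Type) : Type
  | old : OAtom α N → UAtom α N
  | pr : OAtom α N → UAtom α N
  | ap : N → UAtom α N
  | bl : N → UAtom α N
  | ok : N → UAtom α N
  | rdy : N → N → UAtom α N
  | de : N → UAtom α N

def uold {α N : Type} (L : Lit (OAtom α N)) : Lit (UAtom α N) := L.map UAtom.old
def uprimed {α N : Type} (L : Lit (OAtom α N)) : Lit (UAtom α N) := L.map UAtom.pr
def upref {α N : Type} (n m : N) : Lit (UAtom α N) := Lit.pos (UAtom.old (OAtom.pref n m))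
def uapLit {α N : Type} (n : N) : Lit (UAtom α N) := Lit.pos (UAtom.ap n)
def ublLit {α N : Type} (n : N) : Lit (UAtom α N) := Lit.pos (UAtom.bl n)
def uokLit {α N : Type} (n : N) : Lit (UAtom α N) := Lit.pos (UAtom.ok n)
def urdyLit {α N : Type} (n m : N) : Lit (UAtom α N) := Lit.pos (UAtom.rdy n m)
def udeLit {α N : Type} (n : N) : Lit (UAtom α N) := Lit.pos (UAtom.de n)

/-- `a1(r) : head(r') ← ap(n_r)`. -/
def ua1 {α N : Type} (nm : ORule α N → N) (r : ORule α N) : Rule (UAtom α N) :=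
  ⟨uprimed r.head, {uapLit (nm r)}, ∅⟩

/-- `a2(r) : ap(n_r) ← ok(n_r), body(r), not body⁻(r')`. -/
def ua2 {α N : Type} (nm : ORule α N → N) (r : ORule α N) : Rule (UAtom α N) :=
  ⟨uapLit (nm r), insert (uokLit (nm r)) (uold '' r.bodyP),
    uold '' r.bodyN ∪ uprimed '' r.bodyN⟩

/-- `b1(r,L) : bl(n_r) ← ok(n_r), not L, not L'`. -/
def ub1 {α N : Type} (nm : ORule α N → N) (r : ORule α N) (L : Lit (OAtom α N)) :
    Rule (UAtom α N) :=
  ⟨ublLit (nm r), {uokLit (nm r)}, {uold L, uprimed L}⟩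

/-- `b2(r,K) : bl(n_r) ← ok(n_r), K, K'`. -/
def ub2 {α N : Type} (nm : ORule α N → N) (r : ORule α N) (K : Lit (OAtom α N)) :
    Rule (UAtom α N) :=
  ⟨ublLit (nm r), {uokLit (nm r), uold K, uprimed K}, ∅⟩

/-- `c1(r) : ok(n_r) ← rdy(n_r,n_{r_1}), …, rdy(n_r,n_{r_k})`. -/
def uc1 {α N : Type} (P : Set (ORule α N)) (nm : ORule α N → N) (r : ORule α N) :
    Rule (UAtom α N) :=
  ⟨uokLit (nm r), {L | ∃ s ∈ P, L = urdyLit (nm r) (nm s)}, ∅⟩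

/-- `c2(r,s) : rdy(n_r,n_s) ← not (n_r ≺ n_s)`. -/
def uc2 {α N : Type} (nm : ORule α N → N) (r s : ORule α N) : Rule (UAtom α N) :=
  ⟨urdyLit (nm r) (nm s), ∅, {upref (nm r) (nm s)}⟩

/-- `c3(r,s) : rdy(n_r,n_s) ← (n_r ≺ n_s), ap(n_s)`. -/
def uc3 {α N : Type} (nm : ORule α N → N) (r s : ORule α N) : Rule (UAtom α N) :=
  ⟨urdyLit (nm r) (nm s), {upref (nm r) (nm s), uapLit (nm s)}, ∅⟩

/-- `c4(r,s) : rdy(n_r,n_s) ← (n_r ≺ n_s), bl(n_s)`. -/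
def uc4 {α N : Type} (nm : ORule α N → N) (r s : ORule α N) : Rule (UAtom α N) :=
  ⟨urdyLit (nm r) (nm s), {upref (nm r) (nm s), ublLit (nm s)}, ∅⟩

/-- `c5(r,s,J) : rdy(n_r,n_s) ← head(s), J`. -/
def uc5 {α N : Type} (nm : ORule α N → N) (r s : ORule α N) (J : Lit (OAtom α N)) :
    Rule (UAtom α N) :=
  ⟨urdyLit (nm r) (nm s), {uold s.head, uold J}, ∅⟩

/-- The constraint `de(r) : ← not ok(n_r)`, rendered as
`p_r ← not ok(n_r), not p_r` for the fresh atom `p_r = de(n_r)`. -/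
def ude {α N : Type} (nm : ORule α N → N) (r : ORule α N) : Rule (UAtom α N) :=
  ⟨udeLit (nm r), ∅, {uokLit (nm r), udeLit (nm r)}⟩

/-- Transitivity rule inside `𝓛°`. -/
def utr {α N : Type} (nm : ORule α N → N) (r s t : ORule α N) : Rule (UAtom α N) :=
  ⟨upref (nm r) (nm t), {upref (nm r) (nm s), upref (nm s) (nm t)}, ∅⟩

/-- Antisymmetry rule inside `𝓛°`. -/
def uas {α N : Type} (nm : ORule α N → N) (r s : ORule α N) : Rule (UAtom α N) :=
  ⟨Lit.neg (UAtom.old (OAtom.pref (nm s) (nm r))), {upref (nm r) (nm s)}, ∅⟩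

/-- The set of rules `τ(r)` of Definition 8. -/
def utau {α N : Type} (P : Set (ORule α N)) (nm : ORule α N → N) (r : ORule α N) :
    Set (Rule (UAtom α N)) :=
  {ua1 nm r, ua2 nm r, uc1 P nm r, ude nm r}
    ∪ {ru | ∃ L ∈ r.bodyP, ru = ub1 nm r L}
    ∪ {ru | ∃ K ∈ r.bodyN, ru = ub2 nm r K}
    ∪ {ru | ∃ s ∈ P, ru = uc2 nm r s ∨ ru = uc3 nm r s ∨ ru = uc4 nm r s}
    ∪ {ru | ∃ s ∈ P, ∃ J ∈ s.bodyN, ru = uc5 nm r s J}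
    ∪ {ru | ∃ s ∈ P, ∃ t ∈ P, ru = utr nm r s t}
    ∪ {ru | ∃ s ∈ P, ru = uas nm r s}

/-- The translation `𝒰(Π) = Π ∪ ⋃_{r ∈ Π} τ(r)`. -/
def UTrans {α N : Type} (P : Set (ORule α N)) (nm : ORule α N → N) :
    Set (Rule (UAtom α N)) :=
  (Rule.map UAtom.old) '' P ∪ {ru | ∃ r ∈ P, ru ∈ utau P nm r}

/-- The fact `(n_r ≺ n_s) ←` inside `𝓛°`. -/
def uPrefFact {α N : Type} (nm : ORule α N → N) (r s : ORule α N) : Rule (UAtom α N) :=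
  ⟨upref (nm r) (nm s), ∅, ∅⟩

/-- The literals of `𝓛°` over regular atoms (the set `𝓛_𝒜`). -/
def regLitsU {α N : Type} : Set (Lit (UAtom α N)) :=
  {L | ∃ a, L.atom = UAtom.old (OAtom.reg a)}

/-! ## Brewka–Eiter preferred answer sets -/

/-- `reductBE r = head(r) ← not body⁻(r)`. -/
def reductBE {γ : Type} (r : Rule γ) : Rule γ := ⟨r.head, ∅, r.bodyN⟩

/-- The sequence `X_i` of Definition 5 (for the enumeration `l` and the set `X`). -/
def CSeq {γ : Type} (l : List (Rule γ)) (X : Set (Lit γ)) : ℕ → Set (Lit γ)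
  | 0 => ∅
  | i + 1 =>
    CSeq l X i ∪
      {L | ∃ h : i < l.length,
        ¬ defeated (l.get ⟨i, h⟩) (CSeq l X i) ∧
        ¬ ((l.get ⟨i, h⟩).head ∈ X ∧ defeated (l.get ⟨i, h⟩) X) ∧
        L = (l.get ⟨i, h⟩).head}

/-- The operator `C` of Definition 5. -/
def COp {γ : Type} (l : List (Rule γ)) (X : Set (Lit γ)) : Set (Lit γ) :=
  logClosure (⋃ i, CSeq l X i)

/-- `l` is the enumeration of `P` according to the total order `ll`
(most preferred rule first). -/
def descList {γ : Type} (l : List (Rule γ)) (P : Set (Rule γ))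
    (ll : Rule γ → Rule γ → Prop) : Prop :=
  enumerates l P ∧
    ∀ (i j : ℕ) (hi : i < l.length) (hj : j < l.length), i < j →
      ll (l.get ⟨j, hj⟩) (l.get ⟨i, hi⟩)

/-- `X` is the BE-preferred answer set of the fully ordered prerequisite-free
program `(P,ll)`. -/
def BEPrefPF {γ : Type} (P : Set (Rule γ)) (ll : Rule γ → Rule γ → Prop)
    (X : Set (Lit γ)) : Prop :=
  ∃ l, descList l P ll ∧ COp l X = X

/-- The program `Π_X` of Definition 7. -/
def PiX {γ : Type} (P : Set (Rule γ)) (X : Set (Lit γ)) : Set (Rule γ) :=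
  {r' | ∃ r ∈ P, r.bodyP ⊆ X ∧ r' = reductBE r}

/-- `r` is the `ll`-maximal rule of `P` whose BE-reduct is `a`. -/
def beMax {γ : Type} (P : Set (Rule γ)) (ll : Rule γ → Rule γ → Prop)
    (a r : Rule γ) : Prop :=
  r ∈ P ∧ reductBE r = a ∧ ∀ s ∈ P, reductBE s = a → s = r ∨ ll s r

/-- The inherited order `ll_X` of Definition 7. -/
def llX {γ : Type} (P : Set (Rule γ)) (ll : Rule γ → Rule γ → Prop)
    (a b : Rule γ) : Prop :=
  ∃ r1 r2, beMax P ll a r1 ∧ beMax P ll b r2 ∧ ll r1 r2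

/-- `X` is a BE-preferred answer set of the fully ordered program `(P,ll)`. -/
def BEPrefFull {γ : Type} (P : Set (Rule γ)) (ll : Rule γ → Rule γ → Prop)
    (X : Set (Lit γ)) : Prop :=
  answerSet P X ∧ BEPrefPF (PiX P X) (llX P ll) X

/-- `X` is a BE-preferred answer set of the statically ordered program `(P,lt)`. -/
def BEPreferred {γ : Type} (P : Set (Rule γ)) (lt : Rule γ → Rule γ → Prop)
    (X : Set (Lit γ)) : Prop :=
  ∃ ll, totalStrictOn P ll ∧ (∀ a b, lt a b → ll a b) ∧ BEPrefFull P ll X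

/-- `Th P` is closed under the basic program `P`. -/
theorem closedUnder_Th {α : Type} (P : Set (Rule α)) : closedUnder P (Th P) :=
  fun r hr hb Y hY => hY.2 r hr fun _ hL => hb hL Y hY

/-- An answer set contains the head of every undefeated rule whose prerequisites it contains. -/
theorem answerSet.head_mem {α : Type} {P : Set (Rule α)} {X : Set (Lit α)}
    (h : answerSet P X) {r : Rule α} (hr : r ∈ P) (hb : r.bodyP ⊆ X)
    (hd : ¬ defeated r X) : r.head ∈ X := by
  have hc := closedUnder_Th (reduct P X)
  rw [show Th (reduct P X) = X from h] at hc
  exact hc ⟨r.head, r.bodyP, ∅⟩ ⟨r, hr, hd, rfl⟩ hb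

theorem not_defeated_of_bodyN_eq_empty {α : Type} {r : Rule α} (hr : r.bodyN = ∅)
    (X : Set (Lit α)) : ¬ defeated r X := by
  simp [defeated, hr]

/-- The preference relation induced by an answer set of `𝒯(Π)` is transitive. -/
theorem precX_trans {α N : Type} {P : Set (ORule α N)} {nm : ORule α N → N}
    {X : Set (Lit (TAtom α N))} (hAS : answerSet (TTrans P nm) X) {r s t : ORule α N}
    (hr : r ∈ P) (hs : s ∈ P) (ht : t ∈ P) (hrs : precX nm X r s) (hst : precX nm X s t) :
    precX nm X r t := by
  have hmem : tRuleT nm r s t ∈ TTrans P nm :=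
    ⟨r, hr, Or.inl (Or.inr ⟨s, hs, t, ht, rfl⟩)⟩
  exact hAS.head_mem hmem (Set.pair_subset hrs hst) (not_defeated_of_bodyN_eq_empty rfl X)

/-- The preference relation induced by a consistent answer set of `𝒯(Π)` is asymmetric. -/
theorem precX_asymm {α N : Type} {P : Set (ORule α N)} {nm : ORule α N → N}
    {X : Set (Lit (TAtom α N))} (hX : consistent X) (hAS : answerSet (TTrans P nm) X)
    {r s : ORule α N} (hr : r ∈ P) (hs : s ∈ P) (hrs : precX nm X r s) :
    ¬ precX nm X s r := by
  intro hsr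
  have hmem : asRuleT nm r s ∈ TTrans P nm := ⟨r, hr, Or.inr ⟨s, hs, rfl⟩⟩
  exact hX ⟨_, hsr, hAS.head_mem hmem (Set.singleton_subset_iff.mpr hrs)
    (not_defeated_of_bodyN_eq_empty rfl X)⟩

theorem stmt2 {α N : Type} (P : Set (ORule α N)) (nm : ORule α N → N)
    (hfin : P.Finite) (hnm : Set.BijOn nm P Set.univ)
    (X : Set (Lit (TAtom α N))) (hX : consistent X)
    (hAS : answerSet (TTrans P nm) X) :
    (∀ r ∈ P, ∀ s ∈ P, ∀ t ∈ P, precX nm X r s → precX nm X s t → precX nm X r t) ∧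
    (∀ r ∈ P, ∀ s ∈ P, precX nm X r s → ¬ precX nm X s r) ∧
    (∀ r ∈ P, ¬ precX nm X r r) := by
  exact ⟨fun _ hr _ hs _ ht => precX_trans hAS hr hs ht,
    fun _ hr _ hs => precX_asymm hX hAS hr hs,
    fun _ hr hrr => precX_asymm hX hAS hr hr hrr hrr⟩

end ASP
end

section
/- Let Π be an ordered logic program, X a consistent answer set of 𝒯(Π), and Ω = 𝒯(Π)^X the reduct. Then for any r ∈ Π: (1) if r is not defeated by X, ok(n_r) ∈ T_Ω^i(∅), and body⁺(r) ⊆ T_Ω^j(∅), then ap(n_r) ∈ T_Ω^{max(i,j)+1}(∅); (2) if ok(n_r) ∈ T_Ω^i(∅) and body⁺(r) ⊄ X, then bl(n_r) ∈ T_Ω^{i+1}(∅); (3) if r is defeated by X and ok(n_r) ∈ T_Ω^i(∅), then bl(n_r) ∈ T_Ω^j(∅) for some j > i; (4) if ok(n_r) ∉ T_Ω^i(∅), then ap(n_r) ∉ T_Ω^j(∅) and bl(n_r) ∉ T_Ω^k(∅) for all j,k < i+2. -/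
set_option autoImplicit false

namespace ASP

theorem consistent.mono {α : Type} {X Y : Set (Lit α)} (h : X ⊆ Y) (hY : consistent Y) :
    consistent X :=
  fun ⟨a, hp, hn⟩ => hY ⟨a, h hp, h hn⟩

theorem TOp_mono {α : Type} (P : Set (Rule α)) : Monotone (TOp P) := by
  intro X Y h L hL
  by_cases hY : consistent Y
  · rcases hL with ⟨-, r, hr, hb, rfl⟩ | hX
    · exact Or.inl ⟨hY, r, hr, hb.trans h, rfl⟩
    · exact absurd (hY.mono h) hX
  · exact Or.inr hY

theorem TIter_mono {α : Type} (P : Set (Rule α)) : Monotone (TIter P) := by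
  refine monotone_nat_of_le_succ fun n => ?_
  induction n with
  | zero => exact Set.empty_subset _
  | succ n ih => exact TOp_mono P ih

theorem TIter_subset_of_closedUnder {α : Type} {P : Set (Rule α)} {X : Set (Lit α)}
    (hX : consistent X) (hc : closedUnder P X) (n : ℕ) : TIter P n ⊆ X := by
  induction n with
  | zero => exact Set.empty_subset _
  | succ n ih =>
    rintro L (⟨-, r, hr, hb, rfl⟩ | h)
    · exact hc r hr (hb.trans ih)
    · exact absurd (hX.mono ih) h

theorem head_mem_TIter_succ {α : Type} {P : Set (Rule α)} {n : ℕ}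
    (hn : consistent (TIter P n)) {r : Rule α} (hr : r ∈ P) (hb : r.bodyP ⊆ TIter P n) :
    r.head ∈ TIter P (n + 1) :=
  Or.inl ⟨hn, r, hr, hb, rfl⟩

/-- If only finitely many heads occur and all stages are consistent, then the union of the stages
is closed under `P`, even when rule bodies are infinite. -/
theorem closedUnder_iUnion_TIter {α : Type} {P : Set (Rule α)} (hfin : (Rule.head '' P).Finite)
    (hcons : ∀ n, consistent (TIter P n)) : closedUnder P (⋃ n, TIter P n) := by
  intro r hr hb
  have hheads : ⋃ n, TIter P n ⊆ Rule.head '' P := by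
    refine Set.iUnion_subset fun n => ?_
    cases n with
    | zero => exact Set.empty_subset _
    | succ n =>
      rintro L (⟨-, s, hs, -, rfl⟩ | h)
      · exact ⟨s, hs, rfl⟩
      · exact absurd (hcons n) h
  obtain ⟨n, hn⟩ := (TIter_mono P).directed_le.exists_mem_subset_of_finset_subset_biUnion
    (s := (hfin.subset (hb.trans hheads)).toFinset) (by simpa using hb)
  exact Set.mem_iUnion.2 ⟨n + 1, head_mem_TIter_succ (hcons n) hr (by simpa using hn)⟩

theorem Th_subset_iUnion_TIter {α : Type} {P : Set (Rule α)} (hfin : (Rule.head '' P).Finite)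
    (hTh : consistent (Th P)) : Th P ⊆ ⋃ n, TIter P n := by
  have hsub := TIter_subset_of_closedUnder hTh (closedUnder_Th P)
  exact Set.sInter_subset_of_mem ⟨Or.inl (hTh.mono (Set.iUnion_subset hsub)),
    closedUnder_iUnion_TIter hfin fun n => hTh.mono (hsub n)⟩

theorem mk_mem_reduct {α : Type} {P : Set (Rule α)} {X : Set (Lit α)} {r : Rule α} (hr : r ∈ P)
    (hd : ¬ defeated r X) : Rule.mk r.head r.bodyP ∅ ∈ reduct P X :=
  ⟨r, hr, hd, rfl⟩

theorem head_image_reduct_subset {α : Type} (P : Set (Rule α)) (X : Set (Lit α)) :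
    Rule.head '' reduct P X ⊆ Rule.head '' P := by
  rintro _ ⟨_, ⟨r, hr, -, rfl⟩, rfl⟩
  exact ⟨r, hr, rfl⟩

theorem mem_tau_cases {α N : Type} {P : Set (ORule α N)} {nm : ORule α N → N} {r : ORule α N}
    {ru : Rule (TAtom α N)} (h : ru ∈ tau P nm r) :
    ru = a1Rule nm r ∨ ru = a2Rule nm r ∨ ru = c1Rule P nm r ∨ (∃ L ∈ r.bodyP, ru = b1Rule nm r L) ∨
      (∃ L ∈ r.bodyN, ru = b2Rule nm r L) ∨ (∃ s, ru = c2Rule nm r s) ∨ (∃ s, ru = c3Rule nm r s) ∨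
      (∃ s, ru = c4Rule nm r s) ∨ (∃ s t, ru = tRuleT nm r s t) ∨ ∃ s, ru = asRuleT nm r s := by
  simp only [tau, Set.mem_union, Set.mem_insert_iff, Set.mem_singleton_iff, Set.mem_ofPred_eq] at h
  grind

theorem finite_head_image_TTrans {α N : Type} [Finite N] {P : Set (ORule α N)}
    (nm : ORule α N → N) (hfin : P.Finite) : (Rule.head '' TTrans P nm).Finite := by
  refine Set.Finite.subset (s := oldLit '' (Rule.head '' P) ∪ Set.range apLit ∪ Set.range blLit ∪
    Set.range okLit ∪ Set.range (fun p : N × N => rdyLit p.1 p.2) ∪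
    Set.range (fun p : N × N => tpref p.1 p.2) ∪
    Set.range (fun p : N × N => Lit.neg (TAtom.old (OAtom.pref p.1 p.2)))) ?_ ?_
  · simp only [Set.finite_union, Set.finite_range, and_true]
    exact (hfin.image _).image _
  · rintro _ ⟨ru, ⟨r, hr, hru⟩, rfl⟩
    rcases mem_tau_cases hru with rfl | rfl | rfl | ⟨L, -, rfl⟩ | ⟨L, -, rfl⟩ | ⟨s, rfl⟩ | ⟨s, rfl⟩ |
      ⟨s, rfl⟩ | ⟨s, t, rfl⟩ | ⟨s, rfl⟩
    · exact Or.inl (Or.inl (Or.inl (Or.inl (Or.inl (Or.inl ⟨_, ⟨r, hr, rfl⟩, rfl⟩)))))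
    all_goals
      simp [a2Rule, b1Rule, b2Rule, c1Rule, c2Rule, c3Rule, c4Rule, tRuleT, asRuleT]

/-- Every rule deriving `ap(n)` or `bl(n)` has the prerequisite `ok(n)`. -/
theorem okLit_mem_bodyP {α N : Type} {P : Set (ORule α N)} {nm : ORule α N → N} {n : N}
    {ru : Rule (TAtom α N)} (hru : ru ∈ TTrans P nm)
    (hn : ru.head = apLit n ∨ ru.head = blLit n) : okLit n ∈ ru.bodyP := by
  obtain ⟨r, hr, hru⟩ := hru
  have hold : ∀ L : Lit (OAtom α N), oldLit L ≠ apLit n ∧ oldLit L ≠ blLit n := by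
    rintro (a | a) <;> simp [oldLit, Lit.map, apLit, blLit]
  rcases mem_tau_cases hru with rfl | rfl | rfl | ⟨L, -, rfl⟩ | ⟨L, -, rfl⟩ | ⟨s, rfl⟩ | ⟨s, rfl⟩ |
    ⟨s, rfl⟩ | ⟨s, t, rfl⟩ | ⟨s, rfl⟩ <;>
  simp_all [a1Rule, a2Rule, b1Rule, b2Rule, c1Rule, c2Rule, c3Rule, c4Rule, tRuleT, asRuleT,
    apLit, blLit, okLit, rdyLit, tpref]

theorem okLit_mem_TIter {α N : Type} {P : Set (ORule α N)} {nm : ORule α N → N} {n : N}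
    {X L} (hcons : ∀ i, consistent (TIter (reduct (TTrans P nm) X) i))
    (hL : L = apLit n ∨ L = blLit n) {i j : ℕ} (hj : j < i + 2)
    (hmem : L ∈ TIter (reduct (TTrans P nm) X) j) :
    okLit n ∈ TIter (reduct (TTrans P nm) X) i := by
  cases j with
  | zero => exact hmem.elim
  | succ j =>
    rcases hmem with ⟨-, _, ⟨ru, hru, -, rfl⟩, hb, rfl⟩ | h
    · exact TIter_mono _ (by omega) (hb (okLit_mem_bodyP (ru := ru) hru hL))
    · exact absurd (hcons j) h

theorem stmt5 {α N : Type} (P : Set (ORule α N)) (nm : ORule α N → N)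
    (hfin : P.Finite) (hnm : Set.BijOn nm P Set.univ)
    (X : Set (Lit (TAtom α N))) (hX : consistent X)
    (hAS : answerSet (TTrans P nm) X) :
    ∀ r ∈ P,
      (∀ i j : ℕ, ¬ (∃ L ∈ r.bodyN, oldLit L ∈ X) →
        okLit (nm r) ∈ TIter (reduct (TTrans P nm) X) i →
        oldLit '' r.bodyP ⊆ TIter (reduct (TTrans P nm) X) j →
        apLit (nm r) ∈ TIter (reduct (TTrans P nm) X) (max i j + 1)) ∧
      (∀ i : ℕ, okLit (nm r) ∈ TIter (reduct (TTrans P nm) X) i →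
        ¬ oldLit '' r.bodyP ⊆ X →
        blLit (nm r) ∈ TIter (reduct (TTrans P nm) X) (i + 1)) ∧
      (∀ i : ℕ, (∃ L ∈ r.bodyN, oldLit L ∈ X) →
        okLit (nm r) ∈ TIter (reduct (TTrans P nm) X) i →
        ∃ j : ℕ, i < j ∧ blLit (nm r) ∈ TIter (reduct (TTrans P nm) X) j) ∧
      (∀ i : ℕ, okLit (nm r) ∉ TIter (reduct (TTrans P nm) X) i →
        (∀ j : ℕ, j < i + 2 → apLit (nm r) ∉ TIter (reduct (TTrans P nm) X) j) ∧
        (∀ k : ℕ, k < i + 2 → blLit (nm r) ∉ TIter (reduct (TTrans P nm) X) k)) := by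
  have : Finite N := by
    have := hfin.image nm
    rw [hnm.image_eq] at this
    exact Set.finite_univ_iff.1 this
  have hTh : Th (reduct (TTrans P nm) X) = X := hAS
  have hclosed : closedUnder (reduct (TTrans P nm) X) X := by
    have := closedUnder_Th (reduct (TTrans P nm) X)
    rwa [hTh] at this
  have hcons : ∀ n, consistent (TIter (reduct (TTrans P nm) X) n) := fun n =>
    hX.mono (TIter_subset_of_closedUnder hX hclosed n)
  have hsub : X ⊆ ⋃ n, TIter (reduct (TTrans P nm) X) n := by
    have := Th_subset_iUnion_TIter
      ((finite_head_image_TTrans nm hfin).subset (head_image_reduct_subset _ X)) (by rwa [hTh])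
    rwa [hTh] at this
  have hmono := TIter_mono (reduct (TTrans P nm) X)
  intro r hr
  refine ⟨fun i j hd hok hb => ?_, fun i hok hb => ?_, ?_, fun i hok => ⟨?_, ?_⟩⟩
  · refine head_mem_TIter_succ (hcons _) (mk_mem_reduct (r := a2Rule nm r)
      ⟨r, hr, by simp [tau]⟩ ?_) ?_
    · rintro ⟨_, ⟨L, hL, rfl⟩, hLX⟩
      exact hd ⟨L, hL, hLX⟩
    · exact Set.insert_subset (hmono (le_max_left i j) hok) (hb.trans (hmono (le_max_right i j)))
  · obtain ⟨_, ⟨L, hL, rfl⟩, hLX⟩ := Set.not_subset.1 hb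
    refine head_mem_TIter_succ (hcons _) (mk_mem_reduct (r := b1Rule nm r L)
      ⟨r, hr, ?_⟩ ?_) ?_
    · exact Or.inl (Or.inl (Or.inl (Or.inl (Or.inr ⟨L, hL, rfl⟩))))
    · rintro ⟨_, rfl, h⟩
      exact hLX h
    · exact Set.singleton_subset_iff.2 hok
  · rintro i ⟨L, hL, hLX⟩ hok
    obtain ⟨j, hj⟩ := Set.mem_iUnion.1 (hsub hLX)
    refine ⟨max i j + 1, by omega, head_mem_TIter_succ (hcons _)
      (mk_mem_reduct (r := b2Rule nm r L) ⟨r, hr, ?_⟩ ?_) ?_⟩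
    · exact Or.inl (Or.inl (Or.inl (Or.inr ⟨L, hL, rfl⟩)))
    · rintro ⟨_, h, -⟩
      exact h
    · exact Set.insert_subset (hmono (le_max_left i j) hok)
        (Set.singleton_subset_iff.2 (hmono (le_max_right i j) hj))
  · exact fun j hj h => hok (okLit_mem_TIter hcons (Or.inl rfl) hj h)
  · exact fun j hj h => hok (okLit_mem_TIter hcons (Or.inr rfl) hj h)

end ASP
end

section
/- Let Π be an ordered logic program, X a consistent answer set of 𝒯(Π), and ⟨r_i⟩_{i∈I} a grounded enumeration of the set GR(𝒯(Π),X) of generating rules of X from 𝒯(Π). Then for all r,r' ∈ Π: if r <_X r', then j < i, where r_i = c1(r) and r_j = c1(r'). -/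
set_option autoImplicit false

namespace ASP

/-- The heads of the generating rules of an answer set belong to it. -/
theorem head_mem_of_mem_GR {α : Type} {P : Set (Rule α)} {X : Set (Lit α)}
    (hAS : answerSet P X) {ru : Rule α} (hru : ru ∈ GR P X) : ru.head ∈ X := by
  obtain ⟨hP, hb, hd⟩ := hru
  have hsub : ru.bodyP ⊆ Th (reduct P X) := by rw [hAS]; exact hb
  rw [← hAS]
  intro Y hY
  exact hY.2 ⟨ru.head, ru.bodyP, ∅⟩ ⟨ru, hP, hd, rfl⟩ fun L hL => hsub hL Y hY

theorem mem_headsBefore_iff {α : Type} {l : List (Rule α)} {i : ℕ} {L : Lit α} :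
    L ∈ headsBefore l i ↔ ∃ k, ∃ hk : k < l.length, k < i ∧ (l.get ⟨k, hk⟩).head = L := by
  simp only [headsBefore, Set.mem_ofPred_eq, List.mem_map, List.mem_take_iff_getElem,
    List.get_eq_getElem]
  constructor
  · rintro ⟨_, ⟨k, hk, rfl⟩, rfl⟩
    exact ⟨k, by omega, by omega, rfl⟩
  · rintro ⟨k, hk, hki, rfl⟩
    exact ⟨_, ⟨k, by omega, rfl⟩, rfl⟩

/-- In a grounded enumeration of the generating rules of a consistent answer set, every
prerequisite of a rule is the head of an earlier rule. -/
theorem exists_lt_head_eq {α : Type} {P : Set (Rule α)} {X : Set (Lit α)}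
    (hX : consistent X) (hAS : answerSet P X) {l : List (Rule α)}
    (hl : enumerates l (GR P X)) (hg : groundedList l) {i : ℕ} (hi : i < l.length)
    {L : Lit α} (hL : L ∈ (l.get ⟨i, hi⟩).bodyP) :
    ∃ k, ∃ hk : k < l.length, k < i ∧ l.get ⟨k, hk⟩ ∈ GR P X ∧ (l.get ⟨k, hk⟩).head = L := by
  have hmem : ∀ k (hk : k < l.length), l.get ⟨k, hk⟩ ∈ GR P X := fun k hk => by
    rw [← hl.2]
    exact List.get_mem l _
  have hsub : headsBefore l i ⊆ X := by
    intro M hM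
    obtain ⟨k, hk, -, rfl⟩ := mem_headsBefore_iff.1 hM
    exact head_mem_of_mem_GR hAS (hmem k hk)
  have hcons : consistent (headsBefore l i) :=
    fun ⟨a, hp, hn⟩ => hX ⟨a, hsub hp, hsub hn⟩
  obtain ⟨k, hk, hki, hh⟩ := mem_headsBefore_iff.1 (hg i hi hcons hL)
  exact ⟨k, hk, hki, hmem k hk, hh⟩

theorem oldLit_ne_pos {α N : Type} (L : Lit (OAtom α N)) {a : TAtom α N}
    (ha : ∀ b, TAtom.old b ≠ a) : oldLit L ≠ Lit.pos a := by
  cases L with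
  | pos b => exact fun h => ha b (Lit.pos.inj h)
  | neg b => exact fun h => by cases h

/-- The rules of `𝒯(Π)`, listed by shape. -/
theorem mem_TTrans_iff {α N : Type} {P : Set (ORule α N)} {nm : ORule α N → N}
    {ru : Rule (TAtom α N)} :
    ru ∈ TTrans P nm ↔ ∃ r ∈ P, ru = a1Rule nm r ∨ ru = a2Rule nm r ∨ ru = c1Rule P nm r ∨
      (∃ L ∈ r.bodyP, ru = b1Rule nm r L) ∨ (∃ L ∈ r.bodyN, ru = b2Rule nm r L) ∨
      (∃ s ∈ P, ru = c2Rule nm r s ∨ ru = c3Rule nm r s ∨ ru = c4Rule nm r s) ∨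
      (∃ s ∈ P, ∃ t ∈ P, ru = tRuleT nm r s t) ∨ (∃ s ∈ P, ru = asRuleT nm r s) := by
  simp only [TTrans, tau, Set.mem_ofPred_eq, Set.mem_union, Set.mem_insert_iff,
    Set.mem_singleton_iff, or_assoc]

theorem eq_c1Rule_of_head_eq_okLit {α N : Type} {P : Set (ORule α N)} {nm : ORule α N → N}
    {ru : Rule (TAtom α N)} (hru : ru ∈ TTrans P nm) {n : N} (hh : ru.head = okLit n) :
    ∃ r ∈ P, nm r = n ∧ ru = c1Rule P nm r := by
  obtain ⟨r, hr, rfl | rfl | rfl | ⟨L, -, rfl⟩ | ⟨L, -, rfl⟩ | ⟨s, -, rfl | rfl | rfl⟩ |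
    ⟨s, -, t, -, rfl⟩ | ⟨s, -, rfl⟩⟩ := mem_TTrans_iff.1 hru
  case inl => exact absurd hh (oldLit_ne_pos _ (by simp))
  case inr.inr.inl => exact ⟨r, hr, TAtom.ok.inj (Lit.pos.inj hh), rfl⟩
  all_goals cases hh

theorem okLit_mem_bodyP_of_head_eq_apLit {α N : Type} {P : Set (ORule α N)}
    {nm : ORule α N → N} {ru : Rule (TAtom α N)} (hru : ru ∈ TTrans P nm) {n : N}
    (hh : ru.head = apLit n) : okLit n ∈ ru.bodyP := by
  obtain ⟨r, hr, rfl | rfl | rfl | ⟨L, -, rfl⟩ | ⟨L, -, rfl⟩ | ⟨s, -, rfl | rfl | rfl⟩ |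
    ⟨s, -, t, -, rfl⟩ | ⟨s, -, rfl⟩⟩ := mem_TTrans_iff.1 hru
  case inl => exact absurd hh (oldLit_ne_pos _ (by simp))
  case inr.inl => cases hh; exact Set.mem_insert _ _
  all_goals cases hh

theorem okLit_mem_bodyP_of_head_eq_blLit {α N : Type} {P : Set (ORule α N)}
    {nm : ORule α N → N} {ru : Rule (TAtom α N)} (hru : ru ∈ TTrans P nm) {n : N}
    (hh : ru.head = blLit n) : okLit n ∈ ru.bodyP := by
  obtain ⟨r, hr, rfl | rfl | rfl | ⟨L, -, rfl⟩ | ⟨L, -, rfl⟩ | ⟨s, -, rfl | rfl | rfl⟩ |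
    ⟨s, -, t, -, rfl⟩ | ⟨s, -, rfl⟩⟩ := mem_TTrans_iff.1 hru
  case inl => exact absurd hh (oldLit_ne_pos _ (by simp))
  case inr.inr.inr.inl => cases hh; exact rfl
  case inr.inr.inr.inr.inl => cases hh; exact Set.mem_insert _ _
  all_goals cases hh

/-- If `n ≺ m` holds in `X`, then every generating rule for `rdy(n,m)` depends on `ap(m)` or
`bl(m)`. -/
theorem apLit_or_blLit_mem_bodyP_of_head_eq_rdyLit {α N : Type} {P : Set (ORule α N)}
    {nm : ORule α N → N} {X : Set (Lit (TAtom α N))} {ru : Rule (TAtom α N)}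
    (hru : ru ∈ GR (TTrans P nm) X) {n m : N} (hnm : tpref n m ∈ X)
    (hh : ru.head = rdyLit n m) : apLit m ∈ ru.bodyP ∨ blLit m ∈ ru.bodyP := by
  obtain ⟨hT, -, hd⟩ := hru
  obtain ⟨r, hr, rfl | rfl | rfl | ⟨L, -, rfl⟩ | ⟨L, -, rfl⟩ | ⟨s, -, rfl | rfl | rfl⟩ |
    ⟨s, -, t, -, rfl⟩ | ⟨s, -, rfl⟩⟩ := mem_TTrans_iff.1 hT
  case inl => exact absurd hh (oldLit_ne_pos _ (by simp))
  case inr.inr.inr.inr.inr.inl.inl => cases hh; exact absurd ⟨_, rfl, hnm⟩ hd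
  case inr.inr.inr.inr.inr.inl.inr.inl => cases hh; exact Or.inl (Or.inr rfl)
  case inr.inr.inr.inr.inr.inl.inr.inr => cases hh; exact Or.inr (Or.inr rfl)
  all_goals cases hh

theorem stmt6 {α N : Type} (P : Set (ORule α N)) (nm : ORule α N → N)
    (hfin : P.Finite) (hnm : Set.BijOn nm P Set.univ)
    (X : Set (Lit (TAtom α N))) (hX : consistent X)
    (hAS : answerSet (TTrans P nm) X)
    (l : List (Rule (TAtom α N)))
    (hl : enumerates l (GR (TTrans P nm) X)) (hg : groundedList l) :
    ∀ r ∈ P, ∀ s ∈ P, precX nm X r s →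
      ∀ (i j : ℕ) (hi : i < l.length) (hj : j < l.length),
        l.get ⟨i, hi⟩ = c1Rule P nm r → l.get ⟨j, hj⟩ = c1Rule P nm s → j < i := by
  intro r hr s hs hrs i j hi hj hri hsj
  have hrdy : rdyLit (nm r) (nm s) ∈ (l.get ⟨i, hi⟩).bodyP := by
    rw [hri]
    exact ⟨s, hs, rfl⟩
  obtain ⟨k, hk, hki, hkG, hkh⟩ := exists_lt_head_eq hX hAS hl hg hi hrdy
  have hok : ∃ k', ∃ hk' : k' < l.length, k' < k ∧ okLit (nm s) ∈ (l.get ⟨k', hk'⟩).bodyP := by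
    rcases apLit_or_blLit_mem_bodyP_of_head_eq_rdyLit hkG hrs hkh with h | h
    · obtain ⟨k', hk', hlt, hG, hh⟩ := exists_lt_head_eq hX hAS hl hg hk h
      exact ⟨k', hk', hlt, okLit_mem_bodyP_of_head_eq_apLit hG.1 hh⟩
    · obtain ⟨k', hk', hlt, hG, hh⟩ := exists_lt_head_eq hX hAS hl hg hk h
      exact ⟨k', hk', hlt, okLit_mem_bodyP_of_head_eq_blLit hG.1 hh⟩
  obtain ⟨k', hk', hk'k, hok⟩ := hok
  obtain ⟨m, hm, hmk', hG, hh⟩ := exists_lt_head_eq hX hAS hl hg hk' hok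
  obtain ⟨s', hs', hnms, hms⟩ := eq_c1Rule_of_head_eq_okLit hG.1 hh
  obtain rfl := hnm.injOn hs' hs hnms
  have hmj : (⟨m, hm⟩ : Fin l.length) = ⟨j, hj⟩ := hl.1.injective_get (hms.trans hsj.symm)
  have : m = j := congrArg Fin.val hmj
  omega

end ASP
end
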